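/- In ℝ^{13} with the standard almost contact metric structure, with X₁, …, X₇ as in Example 6.2 of the paper (depending on u, v, w, r and a constant k ≠ 0), both φX₃ and φX₄ are orthogonal to span{X₁, …, X₇}; moreover φX₅ = -X₆ and φX₆ = X₅, so span{X₅, X₆} is φ-invariant. -/

import Mathlib

open scoped RealInnerProductSpace

noncomputable section

/-- `ℝ^{13}`, with coordinates indexed by `Fin 6 ⊕ Fin 6 ⊕ Unit`
(the coordinates `x₁,…,x₆, y₁,…,y₆, z`). -/
abbrev E13 := EuclideanSpace ℝ (Fin 6 ⊕ Fin 6 ⊕ Unit)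

/-- The coordinate vector `∂/∂xᵢ`. -/
def dx (i : Fin 6) : E13 := EuclideanSpace.single (.inl i) 1

/-- The coordinate vector `∂/∂yⱼ`. -/
def dy (j : Fin 6) : E13 := EuclideanSpace.single (.inr (.inl j)) 1

/-- The coordinate vector `∂/∂z`. -/
def dz : E13 := EuclideanSpace.single (.inr (.inr ())) 1

lemma inner_dx_dx (i j : Fin 6) : ⟪dx i, dx j⟫ = if i = j then (1 : ℝ) else 0 := by
  simp [dx, EuclideanSpace.inner_single_left]

lemma inner_dy_dy (i j : Fin 6) : ⟪dy i, dy j⟫ = if i = j then (1 : ℝ) else 0 := by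
  simp [dy, EuclideanSpace.inner_single_left]

lemma inner_dx_dy (i j : Fin 6) : ⟪dx i, dy j⟫ = (0 : ℝ) := by
  simp [dx, dy, EuclideanSpace.inner_single_left]

lemma inner_dy_dx (i j : Fin 6) : ⟪dy i, dx j⟫ = (0 : ℝ) := by
  simp [dx, dy, EuclideanSpace.inner_single_left]

lemma inner_dz_dx (i : Fin 6) : ⟪dz, dx i⟫ = (0 : ℝ) := by
  simp [dx, dz, EuclideanSpace.inner_single_left]

lemma inner_dz_dy (i : Fin 6) : ⟪dz, dy i⟫ = (0 : ℝ) := by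
  simp [dy, dz, EuclideanSpace.inner_single_left]

/-- A vector orthogonal to a set is orthogonal to its span. -/
lemma mem_orthogonal_span {E : Type*} [NormedAddCommGroup E] [InnerProductSpace ℝ E]
    {s : Set E} {x : E} (h : ∀ y ∈ s, ⟪y, x⟫ = (0 : ℝ)) : x ∈ (Submodule.span ℝ s)ᗮ := by
  have hs : Submodule.span ℝ s ≤ (ℝ ∙ x)ᗮ :=
    Submodule.span_le.2 fun y hy => Submodule.mem_orthogonal_singleton_iff_inner_left.2 (h y hy)
  exact (Submodule.mem_orthogonal _ _).2 fun y hy =>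
    Submodule.mem_orthogonal_singleton_iff_inner_left.1 (hs hy)

/-- Example 6.2 of the paper. In `ℝ^{13}` with the standard almost
contact metric structure, for the vectors `X₁,…,X₇` given there, both `φ X₃` and `φ X₄`
are orthogonal to `span {X₁,…,X₇}`; moreover `φ X₅ = -X₆` and `φ X₆ = X₅`, so
`span {X₅, X₆}` is `φ`-invariant. -/
theorem example62_antiinvariant_and_invariant
    (φ : E13 →ₗ[ℝ] E13)
    (hx : ∀ i, φ (dx i) = -(dy i))
    (hy : ∀ j, φ (dy j) = dx j)
    (hz : φ dz = 0)
    (u v w r k : ℝ) (hk : k ≠ 0)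
    (X₁ X₂ X₃ X₄ X₅ X₆ X₇ : E13)
    (h1 : X₁ = Real.cos (w + r) • dx 0 + Real.sin (w + r) • dx 1 + k • dx 4
        + Real.cos (w - r) • dy 2 + Real.sin (w - r) • dy 3 - k • dy 4)
    (h2 : X₂ = Real.cos (w - r) • dx 2 + Real.sin (w - r) • dx 3 + k • dx 4
        + Real.cos (w + r) • dy 0 + Real.sin (w + r) • dy 1 + k • dy 4)
    (h3 : X₃ = -(u * Real.sin (w + r)) • dx 0 + (u * Real.cos (w + r)) • dx 1
        - (v * Real.sin (w - r)) • dx 2 + (v * Real.cos (w - r)) • dx 3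
        - (v * Real.sin (w + r)) • dy 0 + (v * Real.cos (w + r)) • dy 1
        - (u * Real.sin (w - r)) • dy 2 + (u * Real.cos (w - r)) • dy 3)
    (h4 : X₄ = -(u * Real.sin (w + r)) • dx 0 + (u * Real.cos (w + r)) • dx 1
        + (v * Real.sin (w - r)) • dx 2 - (v * Real.cos (w - r)) • dx 3
        - (v * Real.sin (w + r)) • dy 0 + (v * Real.cos (w + r)) • dy 1
        + (u * Real.sin (w - r)) • dy 2 - (u * Real.cos (w - r)) • dy 3)
    (h5 : X₅ = dx 5 - dy 5)
    (h6 : X₆ = dx 5 + dy 5)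
    (h7 : X₇ = dz) :
    φ X₃ ∈ (Submodule.span ℝ ({X₁, X₂, X₃, X₄, X₅, X₆, X₇} : Set E13))ᗮ ∧
      φ X₄ ∈ (Submodule.span ℝ ({X₁, X₂, X₃, X₄, X₅, X₆, X₇} : Set E13))ᗮ ∧
      φ X₅ = -X₆ ∧ φ X₆ = X₅ ∧
      ∀ Y ∈ Submodule.span ℝ ({X₅, X₆} : Set E13),
        φ Y ∈ Submodule.span ℝ ({X₅, X₆} : Set E13) := by
  have h56 : φ X₅ = -X₆ := by
    rw [h5, h6, map_sub, hx, hy]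
    abel
  have h65 : φ X₆ = X₅ := by
    rw [h5, h6, map_add, hx, hy]
    abel
  refine ⟨mem_orthogonal_span ?_, mem_orthogonal_span ?_, h56, h65, ?_⟩
  iterate 2
    simp only [Set.mem_insert_iff, Set.mem_singleton_iff]
    rintro y (rfl | rfl | rfl | rfl | rfl | rfl | rfl) <;>
    simp only [h1, h2, h3, h4, h5, h6, h7, map_add, map_sub, map_smul, map_neg, neg_smul, hx, hy,
      inner_add_left, inner_add_right, inner_sub_left, inner_sub_right, inner_neg_left,
      inner_neg_right, real_inner_smul_left, real_inner_smul_right, inner_dx_dx, inner_dy_dy,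
      inner_dx_dy, inner_dy_dx, inner_dz_dx, inner_dz_dy, Fin.reduceEq, if_true, if_false] <;>
    ring
  · intro Y hY
    obtain ⟨a, b, rfl⟩ := Submodule.mem_span_pair.1 hY
    refine Submodule.mem_span_pair.2 ⟨b, -a, ?_⟩
    rw [map_add, map_smul, map_smul, h56, h65]
    module
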